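/- Suppose a user has n⁺ positive items and n⁻ negative items with pairwise distinct scores, let K be an integer with 0 < K ≤ n⁺ and K ≤ n⁻, and suppose exactly m positive items (0 ≤ m ≤ K) are among the K highest-scoring items overall. Then LLPAUC(K/n⁺, K/n⁻) ≤ (2·K·m − m²)/(n⁺·n⁻). -/

import Mathlib

open Finset

open scoped Classical

noncomputable section

/-- The `K` highest-scoring items under the score function `f`: those items
with fewer than `K` items scoring strictly higher (with pairwise distinct
scores these are exactly the top `K` items, provided `K ≤ card`). -/
def topK {α : Type*} [Fintype α] (K : ℕ) (f : α → ℝ) : Finset α :=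
  Finset.univ.filter fun a => (Finset.univ.filter fun b => f a < f b).card < K

/-- Empirical LLPAUC at `(α, β) = (K/n⁺, K/n⁻)`: the fraction (over all
`n⁺ · n⁻` pairs) of pairs `(i, j)` where `i` is one of the `K` highest-scoring
positive items, `j` is one of the `K` highest-scoring negative items, and
`i`'s score exceeds `j`'s score. -/
def llpauc (np nn K : ℕ) (p : Fin np → ℝ) (q : Fin nn → ℝ) : ℝ :=
  (((topK K p ×ˢ topK K q).filter fun ij => q ij.2 < p ij.1).card : ℝ) /
    ((np : ℝ) * (nn : ℝ))

/-- Empirical OPAUC at `β = K/n⁻`: the fraction (over all `n⁺ · n⁻` pairs) of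
pairs `(i, j)` where `i` is any positive item, `j` is one of the `K`
highest-scoring negative items, and `i`'s score exceeds `j`'s score. -/
def opauc (np nn K : ℕ) (p : Fin np → ℝ) (q : Fin nn → ℝ) : ℝ :=
  (((Finset.univ ×ˢ topK K q).filter fun ij : Fin np × Fin nn =>
      q ij.2 < p ij.1).card : ℝ) / ((np : ℝ) * (nn : ℝ))

/-- The number of positive items among the `K` highest-scoring items overall
(positives scored by `p`, negatives scored by `q`). -/
def hitNum (np nn K : ℕ) (p : Fin np → ℝ) (q : Fin nn → ℝ) : ℕ :=
  (Finset.univ.filter fun i : Fin np =>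
    (Finset.univ.filter fun x : Fin np ⊕ Fin nn =>
      p i < Sum.elim p q x).card < K).card

/-- Recall@K: the number of positive items among the `K` highest-scoring items
overall, divided by the number `n⁺` of positive items. -/
def recallK (np nn K : ℕ) (p : Fin np → ℝ) (q : Fin nn → ℝ) : ℝ :=
  (hitNum np nn K p q : ℝ) / (np : ℝ)

/-- Precision@K: the number of positive items among the `K` highest-scoring
items overall, divided by `K`. -/
def precisionK (np nn K : ℕ) (p : Fin np → ℝ) (q : Fin nn → ℝ) : ℝ :=
  (hitNum np nn K p q : ℝ) / (K : ℝ)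

/-- Under an injective score, exactly `K` items are among the `K` highest-scoring. -/
theorem card_topK {α : Type*} [Fintype α] {K : ℕ} {f : α → ℝ}
    (hf : Function.Injective f) (hK : K ≤ Fintype.card α) : (topK K f).card = K := by
  let r : α → ℕ := fun a => (Finset.univ.filter fun b => f a < f b).card
  have hlt : ∀ a b, f a < f b → r b < r a := by
    intro a b hab
    apply Finset.card_lt_card
    refine Finset.ssubset_iff_of_subset ?_ |>.mpr ⟨b, by simpa using hab, by simp⟩
    intro c hc
    simp only [Finset.mem_filter, Finset.mem_univ, true_and] at hc ⊢
    exact hab.trans hc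
  have hr : Function.Injective r := by
    intro a b hab
    by_contra hne
    rcases lt_or_gt_of_ne (hf.ne hne) with h | h
    · exact (hlt a b h).ne hab.symm
    · exact (hlt b a h).ne hab
  have himage : Finset.univ.image r = Finset.range (Fintype.card α) := by
    apply Finset.eq_of_subset_of_card_le
    · intro n hn
      obtain ⟨a, -, rfl⟩ := Finset.mem_image.mp hn
      refine Finset.mem_range.mpr (Finset.card_lt_univ_of_notMem (x := a) ?_)
      simp
    · rw [Finset.card_image_of_injective _ hr, Finset.card_range, Finset.card_univ]
  have htop : (topK K f).image r = Finset.range K := by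
    ext n
    simp only [Finset.mem_image, Finset.mem_range]
    constructor
    · rintro ⟨a, ha, rfl⟩
      exact (Finset.mem_filter.mp ha).2
    · intro hn
      have hmem : n ∈ Finset.univ.image r := by
        rw [himage]
        exact Finset.mem_range.mpr (hn.trans_le hK)
      obtain ⟨a, -, rfl⟩ := Finset.mem_image.mp hmem
      exact ⟨a, Finset.mem_filter.mpr ⟨Finset.mem_univ a, hn⟩, rfl⟩
  rw [← Finset.card_image_of_injective _ hr, htop, Finset.card_range]

/-- Items scoring above a top-`K` item are top-`K` items. -/
theorem mem_topK_of_lt {α : Type*} [Fintype α] {K : ℕ} {f : α → ℝ} {a b : α}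
    (ha : a ∈ topK K f) (hab : f a < f b) : b ∈ topK K f := by
  simp only [topK, Finset.mem_filter, Finset.mem_univ, true_and] at ha ⊢
  refine (Finset.card_le_card ?_).trans_lt ha
  intro c hc
  simp only [Finset.mem_filter, Finset.mem_univ, true_and] at hc ⊢
  exact hab.trans hc

/-- Top-`K` membership passes to subpopulations. -/
theorem mem_topK_comp {α β : Type*} [Fintype α] [Fintype β] {K : ℕ} {f : β → ℝ}
    {g : α → β} (hg : Function.Injective g) {a : α} (ha : g a ∈ topK K f) :
    a ∈ topK K (f ∘ g) := by
  simp only [topK, Finset.mem_filter, Finset.mem_univ, true_and] at ha ⊢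
  rw [← Finset.card_image_of_injective _ hg]
  refine (Finset.card_le_card ?_).trans_lt ha
  intro c hc
  obtain ⟨d, hd, rfl⟩ := Finset.mem_image.mp hc
  simpa using hd

/-- with pairwise distinct scores, `0 < K ≤ n⁺`, `K ≤ n⁻`, and
exactly `m ≤ K` positive items among the `K` highest-scoring items overall,
`LLPAUC(K/n⁺, K/n⁻) ≤ (2·K·m − m²)/(n⁺·n⁻)`. -/
theorem llpauc_le_of_hitNum (np nn K m : ℕ) (p : Fin np → ℝ) (q : Fin nn → ℝ)
    (hinj : Function.Injective (Sum.elim p q))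
    (hK : 0 < K) (hKp : K ≤ np) (hKn : K ≤ nn)
    (hm : hitNum np nn K p q = m) (hmK : m ≤ K) :
    llpauc np nn K p q ≤
      (2 * (K : ℝ) * (m : ℝ) - (m : ℝ) ^ 2) / ((np : ℝ) * (nn : ℝ)) := by
  set H : Finset (Fin np) := Finset.univ.filter fun i => Sum.inl i ∈ topK K (Sum.elim p q)
    with hH
  set N : Finset (Fin nn) := Finset.univ.filter fun j => Sum.inr j ∈ topK K (Sum.elim p q)
    with hN
  have hp : Function.Injective p := hinj.comp Sum.inl_injective
  have hq : Function.Injective q := hinj.comp Sum.inr_injective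
  have hcp : (topK K p).card = K := card_topK hp (by simpa using hKp)
  have hcq : (topK K q).card = K := card_topK hq (by simpa using hKn)
  have hHm : H.card = m := by
    rw [← hm, hitNum]
    congr 1
    ext i
    simp only [hH, topK, Finset.mem_filter, Finset.mem_univ, true_and, Sum.elim_inl]
    congr!
  have hHN : H.card + N.card = K := by
    rw [← card_topK hinj (K := K) (by simp; omega), ← Finset.card_disjSum]
    congr 1
    ext (i | j) <;> simp [hH, hN]
  have hHp : H ⊆ topK K p := fun i hi =>
    mem_topK_comp (f := Sum.elim p q) Sum.inl_injective (Finset.mem_filter.mp hi).2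
  have hNq : N ⊆ topK K q := fun j hj =>
    mem_topK_comp (f := Sum.elim p q) Sum.inr_injective (Finset.mem_filter.mp hj).2
  have hsub : ((topK K p ×ˢ topK K q).filter fun ij => q ij.2 < p ij.1) ⊆
      H ×ˢ topK K q ∪ (topK K p \ H) ×ˢ (topK K q \ N) := by
    rintro ⟨i, j⟩ hij
    simp only [Finset.mem_filter, Finset.mem_product] at hij
    obtain ⟨⟨hi, hj⟩, hlt⟩ := hij
    simp only [Finset.mem_union, Finset.mem_product, Finset.mem_sdiff]
    by_cases hiH : i ∈ H
    · exact Or.inl ⟨hiH, hj⟩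
    · refine Or.inr ⟨⟨hi, hiH⟩, hj, fun hjN => hiH ?_⟩
      exact Finset.mem_filter.mpr ⟨Finset.mem_univ i,
        mem_topK_of_lt (Finset.mem_filter.mp hjN).2 hlt⟩
  have hcard := (Finset.card_le_card hsub).trans (Finset.card_union_le _ _)
  rw [Finset.card_product, Finset.card_product, Finset.card_sdiff_of_subset hHp,
    Finset.card_sdiff_of_subset hNq, hcp, hcq, hHm,
    show K - N.card = m by omega] at hcard
  have hcard' := (Nat.cast_le (α := ℝ)).mpr hcard
  push_cast [Nat.cast_sub hmK] at hcard'
  unfold llpauc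
  gcongr
  linarith
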